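/- Let p be a prime, m ∈ ℕ, let h ∈ ℚ(p^m), σ_m ∈ ℚ(p^m), and γ > 0. Then p^m ∫_0^{p^{−m}} [ 1 + γ(1 − h ⊕_p (σ_m + δ)) ] dδ = − (γ/2) p^{−m} + 1 + γ − γ (h ⊕_{p,m}^{simp} σ_m). -/

import Mathlib

open MeasureTheory Finset

/-- The digit of `x ∈ [0,1)` at base-`p` position `r` (the coefficient of `p^{-(r+1)}`),
using the finite expansion for `p`-adic rationals. -/
noncomputable def rdigit (p : ℕ) (x : ℝ) (r : ℕ) : ℕ :=
  (⌊x * (p : ℝ) ^ (r + 1)⌋).toNat % p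

/-- The value of the `p`-adic integer `φ_p^+(x)` modulo `p^m`, as a natural number. -/
noncomputable def truncVal (p : ℕ) (x : ℝ) (m : ℕ) : ℕ :=
  ∑ r ∈ Finset.range m, rdigit p x r * p ^ r

/-- Digit `r` of the `p`-adic sum `φ_p^+(x) +_{ℤ_p} φ_p^+(σ)`. -/
noncomputable def sdigit (p : ℕ) (x σ : ℝ) (r : ℕ) : ℕ :=
  (truncVal p x (r + 1) + truncVal p σ (r + 1)) % p ^ (r + 1) / p ^ r

/-- The `p`-adic shift `x ⊕_p σ = φ_p(φ_p^+(x) +_{ℤ_p} φ_p^+(σ))` (the Monna map applied to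
the `p`-adic sum, taken mod 1). -/
noncomputable def pshift (p : ℕ) (x σ : ℝ) : ℝ :=
  Int.fract (∑' r : ℕ, (sdigit p x σ r : ℝ) / (p : ℝ) ^ (r + 1))

/-- The simplified `p`-adic shift `x ⊕_{p,m}^{simp} σ`: the truncation of `x ⊕_p σ` to its `m`
most significant base-`p` digits. -/
noncomputable def simpShift (p m : ℕ) (x σ : ℝ) : ℝ :=
  ∑ r ∈ Finset.range m, (sdigit p x σ r : ℝ) / (p : ℝ) ^ (r + 1)

/-- The mid-simplified `p`-adic shift `x ⊕_{p,m}^{simi} σ = (x ⊕_{p,m}^{simp} σ) + 1/(2p^m)`. -/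
noncomputable def midShift (p m : ℕ) (x σ : ℝ) : ℝ :=
  simpShift p m x σ + 1 / (2 * (p : ℝ) ^ m)

/-- The radical inverse function `φ_p(n) = Σ_r n_r p^{-(r+1)}` in base `p`. -/
noncomputable def radInv (p n : ℕ) : ℝ :=
  ∑' r : ℕ, ((n / p ^ r % p : ℕ) : ℝ) / (p : ℝ) ^ (r + 1)

/-- Membership in `ℚ(p^m) = {a p^{-m} : a = 0,1,…,p^m - 1}`. -/
def QSet (p m : ℕ) (x : ℝ) : Prop :=
  ∃ a : ℕ, a < p ^ m ∧ x = (a : ℝ) / (p : ℝ) ^ m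

/-- The squared worst-case error of the QMC rule based on the `N`-element point set
`P ⊆ [0,1)^d` in the weighted anchored Sobolev space with weights `γ` (0-indexed, so the
paper's `γ_j` is `γ (j-1)`). -/
noncomputable def sqErr (d N : ℕ) (γ : ℕ → ℝ) (P : Fin N → Fin d → ℝ) : ℝ :=
  (∏ j : Fin d, (1 + γ j.val / 3))
    - 2 / (N : ℝ) * ∑ n : Fin N, ∏ j : Fin d, (1 + γ j.val / 2 * (1 - P n j ^ 2))
    + 1 / (N : ℝ) ^ 2 *
        ∑ n : Fin N, ∑ h : Fin N, ∏ j : Fin d, (1 + γ j.val * min (1 - P n j) (1 - P h j))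

lemma rdigit_eq_floor_mod (p : ℕ) (x : ℝ) (r : ℕ) :
    rdigit p x r = ⌊x * (p : ℝ) ^ (r + 1)⌋₊ % p := by
  rw [rdigit, Int.floor_toNat]

lemma floor_mul_pow_succ_div {p : ℕ} (hp : 0 < p) (x : ℝ) (r : ℕ) :
    ⌊x * (p : ℝ) ^ (r + 1)⌋₊ / p = ⌊x * (p : ℝ) ^ r⌋₊ := by
  have hp' : (p : ℝ) ≠ 0 := by positivity
  rw [← Nat.floor_div_natCast]
  congr 1
  field_simp
  ring

lemma floor_mul_pow_add_div {p : ℕ} (hp : 0 < p) (x : ℝ) (r k : ℕ) :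
    ⌊x * (p : ℝ) ^ (r + k)⌋₊ / p ^ k = ⌊x * (p : ℝ) ^ r⌋₊ := by
  induction k with
  | zero => simp
  | succ k ih =>
    rw [pow_succ', ← Nat.div_div_eq_div_mul, ← add_assoc, floor_mul_pow_succ_div hp, ih]

/-- The first `r` base-`p` digits of `x`, read off from `n = ⌊x p ^ r⌋` and reversed. -/
def revDigits (p r n : ℕ) : ℕ :=
  ∑ i ∈ Finset.range r, n / p ^ (r - (i + 1)) % p * p ^ i

lemma truncVal_eq_revDigits {p : ℕ} (hp : 0 < p) (x : ℝ) (r : ℕ) :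
    truncVal p x r = revDigits p r ⌊x * (p : ℝ) ^ r⌋₊ := by
  refine Finset.sum_congr rfl fun i hi => ?_
  have h := floor_mul_pow_add_div hp x (i + 1) (r - (i + 1))
  rw [Nat.add_sub_cancel' (Finset.mem_range.mp hi)] at h
  rw [rdigit_eq_floor_mod, h]

/-- Digit `r` of the `p`-adic sum as a function of `n = ⌊σ p ^ (r + 1)⌋`. -/
noncomputable def cellDigit (p : ℕ) (x : ℝ) (r n : ℕ) : ℕ :=
  ((truncVal p x (r + 1) + revDigits p r (n / p)) / p ^ r + n % p) % p

lemma sdigit_eq_cellDigit {p : ℕ} (hp : 0 < p) (x σ : ℝ) (r : ℕ) :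
    sdigit p x σ r = cellDigit p x r ⌊σ * (p : ℝ) ^ (r + 1)⌋₊ := by
  have hr : 0 < p ^ r := by positivity
  have h : truncVal p σ (r + 1) = truncVal p σ r + rdigit p σ r * p ^ r :=
    Finset.sum_range_succ _ _
  rw [sdigit, cellDigit, h, floor_mul_pow_succ_div hp, ← truncVal_eq_revDigits hp,
    ← rdigit_eq_floor_mod, ← add_assoc, pow_succ p r, Nat.mod_mul_right_div_self,
    Nat.add_mul_div_right _ _ hr]

lemma sdigit_lt {p : ℕ} (hp : 0 < p) (x σ : ℝ) (r : ℕ) : sdigit p x σ r < p := by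
  rw [sdigit_eq_cellDigit hp]
  exact Nat.mod_lt _ hp

lemma measurable_sdigit {p : ℕ} (hp : 0 < p) (x : ℝ) (r : ℕ) :
    Measurable fun σ => (sdigit p x σ r : ℝ) := by
  simp_rw [sdigit_eq_cellDigit hp]
  exact (measurable_from_nat (f := fun n => (cellDigit p x r n : ℝ))).comp
    (Nat.measurable_floor.comp (measurable_id.mul_const _))

lemma floor_eq_of_mem_cell {L : ℝ} (hL : 0 < L) {n : ℕ} {x : ℝ}
    (hx : x ∈ Set.Ico ((n : ℝ) / L) ((n + 1 : ℕ) / L)) : ⌊x * L⌋₊ = n := by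
  have h0 : (0 : ℝ) ≤ x * L := by
    have : (0 : ℝ) ≤ n / L := by positivity
    exact mul_nonneg (this.trans hx.1) hL.le
  rw [Nat.floor_eq_iff h0]
  have h2 := hx.2
  push_cast at h2
  exact ⟨(div_le_iff₀ hL).mp hx.1, (lt_div_iff₀ hL).mp h2⟩

lemma setIntegral_floor_cell (g : ℕ → ℝ) {L : ℝ} (hL : 0 < L) (n : ℕ) :
    ∫ x in Set.Ico ((n : ℝ) / L) ((n + 1 : ℕ) / L), g ⌊x * L⌋₊ = g n / L := by
  rw [setIntegral_congr_fun (g := fun _ => g n) measurableSet_Ico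
    (fun x hx => by simp only [floor_eq_of_mem_cell hL hx])]
  have h : ((n + 1 : ℕ) : ℝ) / L - n / L = 1 / L := by push_cast; ring
  rw [setIntegral_const, Measure.real, Real.volume_Ico, h,
    ENNReal.toReal_ofReal (by positivity), smul_eq_mul]
  ring

lemma integrableOn_floor_cell (g : ℕ → ℝ) {L : ℝ} (hL : 0 < L) (n : ℕ) :
    IntegrableOn (fun x : ℝ => g ⌊x * L⌋₊) (Set.Ico ((n : ℝ) / L) ((n + 1 : ℕ) / L)) := by
  refine (integrableOn_const (C := g n) (by simp)).congr_fun (fun x hx => ?_) measurableSet_Ico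
  simp only [floor_eq_of_mem_cell hL hx]

/-- The integral of a step function with steps of length `1 / L`. -/
lemma setIntegral_floor (g : ℕ → ℝ) {L : ℝ} (hL : 0 < L) {a b : ℕ} (hab : a ≤ b) :
    IntegrableOn (fun x : ℝ => g ⌊x * L⌋₊) (Set.Ico ((a : ℝ) / L) (b / L)) ∧
    ∫ x in Set.Ico ((a : ℝ) / L) (b / L), g ⌊x * L⌋₊ = (∑ n ∈ Finset.Ico a b, g n) / L := by
  induction b, hab using Nat.le_induction with
  | base => simp
  | succ b hab ih =>
    have h1 : (a : ℝ) / L ≤ b / L := by gcongr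
    have h2 : (b : ℝ) / L ≤ (b + 1 : ℕ) / L := by gcongr; simp
    have hd : Disjoint (Set.Ico ((a : ℝ) / L) (b / L)) (Set.Ico ((b : ℝ) / L) ((b + 1 : ℕ) / L)) :=
      Set.Ico_disjoint_Ico_same
    rw [← Set.Ico_union_Ico_eq_Ico h1 h2]
    refine ⟨ih.1.union (integrableOn_floor_cell g hL b), ?_⟩
    rw [setIntegral_union hd measurableSet_Ico ih.1 (integrableOn_floor_cell g hL b), ih.2,
      setIntegral_floor_cell g hL, Finset.sum_Ico_succ_top hab, add_div]

lemma sum_Ico_mul_eq (g : ℕ → ℝ) (p : ℕ) {a b : ℕ} (hab : a ≤ b) :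
    ∑ n ∈ Finset.Ico (a * p) (b * p), g n
      = ∑ k ∈ Finset.Ico a b, ∑ j ∈ Finset.range p, g (k * p + j) := by
  induction b, hab using Nat.le_induction with
  | base => simp
  | succ b hab ih =>
    rw [Finset.sum_Ico_succ_top hab, ← ih,
      ← Finset.sum_Ico_consecutive g (Nat.mul_le_mul_right p hab)
        (Nat.mul_le_mul_right p b.le_succ), Finset.sum_Ico_eq_sum_range g (b * p)]
    simp [Nat.succ_mul]

lemma sum_range_add_mod (p c : ℕ) :
    ∑ j ∈ Finset.range p, (c + j) % p = ∑ j ∈ Finset.range p, j := by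
  induction c with
  | zero => exact Finset.sum_congr rfl fun j hj => by simp [Nat.mod_eq_of_lt (Finset.mem_range.mp hj)]
  | succ c ih =>
    rw [← ih]
    have h1 := Finset.sum_range_succ (fun j => (c + j) % p) p
    have h2 := Finset.sum_range_succ' (fun j => (c + j) % p) p
    simp only [Nat.add_mod_right, Nat.add_zero] at h1 h2
    have h3 : ∀ j, c + 1 + j = c + (j + 1) := fun j => by omega
    simp only [h3]
    omega

lemma sum_cellDigit {p : ℕ} (hp : 0 < p) (x : ℝ) (r k : ℕ) :
    ∑ j ∈ Finset.range p, (cellDigit p x r (k * p + j) : ℝ) = p * (p - 1) / 2 := by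
  have h : ∀ j ∈ Finset.range p, cellDigit p x r (k * p + j)
      = ((truncVal p x (r + 1) + revDigits p r k) / p ^ r + j) % p := by
    intro j hj
    have hj := Finset.mem_range.mp hj
    have h1 : (k * p + j) / p = k := by
      rw [add_comm, Nat.add_mul_div_right _ _ hp, Nat.div_eq_of_lt hj, zero_add]
    have h2 : (k * p + j) % p = j := by
      rw [add_comm, Nat.add_mul_mod_self_right, Nat.mod_eq_of_lt hj]
    rw [cellDigit, h1, h2]
  rw [← Nat.cast_sum, Finset.sum_congr rfl h, sum_range_add_mod]
  have h3 := Finset.sum_range_id_mul_two p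
  have h4 : ((∑ i ∈ Finset.range p, i : ℕ) : ℝ) * 2 = p * (p - 1) := by
    rw [← Nat.cast_pred hp]
    exact_mod_cast h3
  linarith

/-- Beyond the resolution of a cell of length `p ^ (-m)`, the digits of the `p`-adic sum
are equidistributed on that cell. -/
lemma setIntegral_sdigit_add {p : ℕ} (hp : 0 < p) (x : ℝ) (m s a : ℕ) :
    ∫ σ in Set.Ico ((a : ℝ) / (p : ℝ) ^ m) ((a + 1 : ℕ) / (p : ℝ) ^ m),
      (sdigit p x σ (s + m) : ℝ) = ((p : ℝ) - 1) / 2 * ((p : ℝ) ^ m)⁻¹ := by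
  have hp' : (0 : ℝ) < p := by positivity
  have hscale : ∀ b : ℕ, (b : ℝ) / (p : ℝ) ^ m
      = ((b * p ^ s * p : ℕ) : ℝ) / (p : ℝ) ^ (s + m + 1) := by
    intro b
    push_cast
    field_simp
    ring
  have hle : a * p ^ s ≤ (a + 1) * p ^ s := Nat.mul_le_mul_right _ a.le_succ
  simp_rw [sdigit_eq_cellDigit hp]
  rw [hscale a, hscale (a + 1), (setIntegral_floor
    (fun n => (cellDigit p x (s + m) n : ℝ)) (by positivity) (Nat.mul_le_mul_right p hle)).2,
    sum_Ico_mul_eq _ _ hle]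
  simp_rw [sum_cellDigit hp]
  rw [Finset.sum_const, Nat.card_Ico, Nat.succ_mul, Nat.add_sub_cancel_left, nsmul_eq_mul]
  push_cast
  field_simp
  ring

lemma sdigit_congr_of_floor_eq {p : ℕ} (hp : 0 < p) (x : ℝ) {σ τ : ℝ} {m r : ℕ} (hr : r < m)
    (h : ⌊σ * (p : ℝ) ^ m⌋₊ = ⌊τ * (p : ℝ) ^ m⌋₊) : sdigit p x σ r = sdigit p x τ r := by
  obtain ⟨k, rfl⟩ := Nat.exists_eq_add_of_le hr
  rw [sdigit_eq_cellDigit hp, sdigit_eq_cellDigit hp, ← floor_mul_pow_add_div hp σ _ k,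
    ← floor_mul_pow_add_div hp τ _ k, h]

lemma floor_eq_of_sdigit_eq {p : ℕ} (hp : 0 < p) (x : ℝ) {σ τ : ℝ} (h0 : ⌊σ⌋₊ = ⌊τ⌋₊)
    (h : ∀ r, sdigit p x σ r = sdigit p x τ r) (r : ℕ) :
    ⌊σ * (p : ℝ) ^ r⌋₊ = ⌊τ * (p : ℝ) ^ r⌋₊ := by
  induction r with
  | zero => simpa using h0
  | succ r ih =>
    have hr := h r
    rw [sdigit_eq_cellDigit hp, sdigit_eq_cellDigit hp, cellDigit, cellDigit,
      floor_mul_pow_succ_div hp, floor_mul_pow_succ_div hp, ih] at hr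
    have hmod := Nat.ModEq.add_left_cancel' _ (show _ ≡ _ [MOD p] from hr)
    rw [Nat.ModEq, Nat.mod_mod, Nat.mod_mod] at hmod
    rw [← Nat.div_add_mod ⌊σ * (p : ℝ) ^ (r + 1)⌋₊ p, hmod, floor_mul_pow_succ_div hp, ih,
      ← floor_mul_pow_succ_div hp, Nat.div_add_mod]

lemma eq_of_sdigit_eq {p : ℕ} (hp : 1 < p) (x : ℝ) {σ τ : ℝ} (hσ : 0 ≤ σ) (hτ : 0 ≤ τ)
    (h0 : ⌊σ⌋₊ = ⌊τ⌋₊) (h : ∀ r, sdigit p x σ r = sdigit p x τ r) : σ = τ := by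
  by_contra hne
  have hpos : 0 < |σ - τ| := abs_pos.mpr (sub_ne_zero.mpr hne)
  obtain ⟨r, hr⟩ := pow_unbounded_of_one_lt |σ - τ|⁻¹ (show (1 : ℝ) < p by exact_mod_cast hp)
  have hfl := floor_eq_of_sdigit_eq (by omega) x h0 h r
  have hpr : (0 : ℝ) < (p : ℝ) ^ r := by positivity
  have h1 := Nat.floor_le (mul_nonneg hσ hpr.le)
  have h2 := Nat.lt_floor_add_one (σ * (p : ℝ) ^ r)
  have h3 := Nat.floor_le (mul_nonneg hτ hpr.le)
  have h4 := Nat.lt_floor_add_one (τ * (p : ℝ) ^ r)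
  rw [hfl] at h1 h2
  have h5 : |σ - τ| * (p : ℝ) ^ r < 1 := by
    rw [← abs_of_pos hpr, ← abs_mul, abs_lt]
    constructor <;> linarith
  have h6 := mul_lt_mul_of_pos_left hr hpos
  rw [mul_inv_cancel₀ hpos.ne'] at h6
  linarith

lemma hasSum_pred_div_pow {p : ℕ} (hp : 1 < p) :
    HasSum (fun r : ℕ => ((p : ℝ) - 1) / (p : ℝ) ^ (r + 1)) 1 := by
  have hp' : (1 : ℝ) < p := by exact_mod_cast hp
  have h := (hasSum_geometric_of_lt_one (by positivity) (inv_lt_one_of_one_lt₀ hp')).mul_left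
    (((p : ℝ) - 1) / p)
  have h1 : (p : ℝ) - 1 ≠ 0 := by linarith
  have h2 : ((p : ℝ) - 1) / p * (1 - (p : ℝ)⁻¹)⁻¹ = 1 := by
    rw [show 1 - (p : ℝ)⁻¹ = ((p : ℝ) - 1) / p by field_simp]
    exact mul_inv_cancel₀ (by positivity)
  rw [h2] at h
  refine h.congr_fun fun r => ?_
  rw [inv_pow, pow_succ]
  field_simp

lemma sdigit_le_pred {p : ℕ} (hp : 0 < p) (x σ : ℝ) (r : ℕ) :
    (sdigit p x σ r : ℝ) ≤ (p : ℝ) - 1 := by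
  have h : ((sdigit p x σ r + 1 : ℕ) : ℝ) ≤ p := by exact_mod_cast sdigit_lt hp x σ r
  push_cast at h
  linarith

lemma sdigit_div_le {p : ℕ} (hp : 0 < p) (x σ : ℝ) (r : ℕ) :
    (sdigit p x σ r : ℝ) / (p : ℝ) ^ (r + 1) ≤ ((p : ℝ) - 1) / (p : ℝ) ^ (r + 1) := by
  have := sdigit_le_pred hp x σ r
  gcongr

lemma summable_sdigit {p : ℕ} (hp : 1 < p) (x σ : ℝ) :
    Summable fun r : ℕ => (sdigit p x σ r : ℝ) / (p : ℝ) ^ (r + 1) :=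
  (hasSum_pred_div_pow hp).summable.of_nonneg_of_le (fun r => by positivity)
    (sdigit_div_le (by omega) x σ)

lemma sdigit_eq_pred_of_one_le_tsum {p : ℕ} (hp : 1 < p) (x σ : ℝ)
    (h : 1 ≤ ∑' r : ℕ, (sdigit p x σ r : ℝ) / (p : ℝ) ^ (r + 1)) (r : ℕ) :
    sdigit p x σ r = p - 1 := by
  by_contra hne
  have hlt := sdigit_lt (p := p) (by omega) x σ r
  have hlt' : (sdigit p x σ r : ℝ) < (p : ℝ) - 1 := by
    have : ((sdigit p x σ r + 1 : ℕ) : ℝ) < p := by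
      exact Nat.cast_lt.mpr (by omega)
    push_cast at this
    linarith
  have := (summable_sdigit hp x σ).tsum_lt_tsum (sdigit_div_le (by omega) x σ)
    (show (sdigit p x σ r : ℝ) / (p : ℝ) ^ (r + 1) < ((p : ℝ) - 1) / (p : ℝ) ^ (r + 1) by
      gcongr) (hasSum_pred_div_pow hp).summable
  rw [(hasSum_pred_div_pow hp).tsum_eq] at this
  linarith

lemma pshift_ae_eq_tsum {p : ℕ} (hp : 1 < p) (x : ℝ) :
    ∀ᵐ σ : ℝ, σ ∈ Set.Ico (0 : ℝ) 1 →
      pshift p x σ = ∑' r : ℕ, (sdigit p x σ r : ℝ) / (p : ℝ) ^ (r + 1) := by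
  have hsub : {σ : ℝ | σ ∈ Set.Ico (0 : ℝ) 1 ∧
      1 ≤ ∑' r : ℕ, (sdigit p x σ r : ℝ) / (p : ℝ) ^ (r + 1)}.Subsingleton := by
    rintro σ ⟨hσ, hσ1⟩ τ ⟨hτ, hτ1⟩
    refine eq_of_sdigit_eq hp x hσ.1 hτ.1 ?_ fun r => ?_
    · rw [Nat.floor_eq_zero.mpr hσ.2, Nat.floor_eq_zero.mpr hτ.2]
    · rw [sdigit_eq_pred_of_one_le_tsum hp x σ hσ1, sdigit_eq_pred_of_one_le_tsum hp x τ hτ1]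
  filter_upwards [measure_eq_zero_iff_ae_notMem.mp (hsub.measure_zero volume)] with σ hσ hmem
  exact Int.fract_eq_self.mpr ⟨tsum_nonneg fun r => by positivity,
    not_le.mp fun h => hσ ⟨hmem, h⟩⟩

lemma integrableOn_pshift_and_hasSum {p : ℕ} (hp : 1 < p) (x : ℝ) (m a : ℕ) (ha : a < p ^ m) :
    IntegrableOn (pshift p x)
      (Set.Ico ((a : ℝ) / (p : ℝ) ^ m) ((a + 1 : ℕ) / (p : ℝ) ^ m)) ∧
    HasSum (fun r : ℕ => ∫ σ in Set.Ico ((a : ℝ) / (p : ℝ) ^ m) ((a + 1 : ℕ) / (p : ℝ) ^ m),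
        (sdigit p x σ r : ℝ) / (p : ℝ) ^ (r + 1))
      (∫ σ in Set.Ico ((a : ℝ) / (p : ℝ) ^ m) ((a + 1 : ℕ) / (p : ℝ) ^ m), pshift p x σ) := by
  have hp0 : 0 < p := by omega
  have hpm : (0 : ℝ) < (p : ℝ) ^ m := by positivity
  have hsub : Set.Ico ((a : ℝ) / (p : ℝ) ^ m) ((a + 1 : ℕ) / (p : ℝ) ^ m)
      ⊆ Set.Ico (0 : ℝ) 1 := by
    refine Set.Ico_subset_Ico (by positivity) ?_
    rw [div_le_one hpm]
    exact_mod_cast ha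
  have hae : (fun σ => ∑' r : ℕ, (sdigit p x σ r : ℝ) / (p : ℝ) ^ (r + 1)) =ᵐ[volume.restrict
      (Set.Ico ((a : ℝ) / (p : ℝ) ^ m) ((a + 1 : ℕ) / (p : ℝ) ^ m))] pshift p x := by
    filter_upwards [ae_restrict_of_ae (pshift_ae_eq_tsum hp x),
      ae_restrict_mem measurableSet_Ico] with σ h hσ
    exact (h (hsub hσ)).symm
  have hmeas : ∀ r : ℕ, Measurable fun σ => (sdigit p x σ r : ℝ) / (p : ℝ) ^ (r + 1) :=
    fun r => (measurable_sdigit hp0 x r).div_const _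
  have hnorm : ∀ (r : ℕ) (σ : ℝ), ‖(sdigit p x σ r : ℝ) / (p : ℝ) ^ (r + 1)‖
      ≤ ((p : ℝ) - 1) / (p : ℝ) ^ (r + 1) := fun r σ => by
    rw [Real.norm_of_nonneg (by positivity)]
    exact sdigit_div_le hp0 x σ r
  constructor
  · refine Integrable.congr ?_ hae
    refine Integrable.of_bound (C := 1)
      (Measurable.tsum hmeas).aestronglyMeasurable ?_
    refine Filter.Eventually.of_forall fun σ => ?_
    exact tsum_of_norm_bounded (hasSum_pred_div_pow hp) (hnorm · σ)
  · rw [← integral_congr_ae hae]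
    refine hasSum_integral_of_dominated_convergence
      (fun r _ => ((p : ℝ) - 1) / (p : ℝ) ^ (r + 1))
      (fun r => (hmeas r).aestronglyMeasurable)
      (fun r => Filter.Eventually.of_forall (hnorm r))
      (Filter.Eventually.of_forall fun _ => (hasSum_pred_div_pow hp).summable)
      (integrable_const _)
      (Filter.Eventually.of_forall fun σ => (summable_sdigit hp x σ).hasSum)

lemma setIntegral_pshift {p : ℕ} (hp : 1 < p) (x : ℝ) (m a : ℕ) (ha : a < p ^ m) :
    ∫ σ in Set.Ico ((a : ℝ) / (p : ℝ) ^ m) ((a + 1 : ℕ) / (p : ℝ) ^ m), pshift p x σ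
      = ((p : ℝ) ^ m)⁻¹ * (simpShift p m x (a / (p : ℝ) ^ m) + ((p : ℝ) ^ m)⁻¹ / 2) := by
  have hp0 : 0 < p := by omega
  have hpm : (0 : ℝ) < (p : ℝ) ^ m := by positivity
  have hsum := (integrableOn_pshift_and_hasSum hp x m a ha).2
  rw [← hsum.tsum_eq, ← hsum.summable.sum_add_tsum_nat_add m, mul_add, simpShift, Finset.mul_sum]
  congr 1
  · refine Finset.sum_congr rfl fun r hr => ?_
    have hcell : ∀ σ ∈ Set.Ico ((a : ℝ) / (p : ℝ) ^ m) ((a + 1 : ℕ) / (p : ℝ) ^ m),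
        (sdigit p x σ r : ℝ) / (p : ℝ) ^ (r + 1)
          = (sdigit p x (a / (p : ℝ) ^ m) r : ℝ) / (p : ℝ) ^ (r + 1) := by
      intro σ hσ
      rw [sdigit_congr_of_floor_eq hp0 x (Finset.mem_range.mp hr)]
      rw [floor_eq_of_mem_cell hpm hσ, div_mul_cancel₀ _ hpm.ne', Nat.floor_natCast]
    have hvol : ((a + 1 : ℕ) : ℝ) / (p : ℝ) ^ m - a / (p : ℝ) ^ m = ((p : ℝ) ^ m)⁻¹ := by
      push_cast; ring
    rw [setIntegral_congr_fun measurableSet_Ico hcell, setIntegral_const, Measure.real,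
      Real.volume_Ico, hvol, ENNReal.toReal_ofReal (by positivity), smul_eq_mul]
  · simp_rw [integral_div, setIntegral_sdigit_add hp0]
    have hterm : ∀ s : ℕ, ((p : ℝ) - 1) / 2 * ((p : ℝ) ^ m)⁻¹ / (p : ℝ) ^ (s + m + 1)
        = ((p : ℝ) ^ m)⁻¹ * (((p : ℝ) ^ m)⁻¹ / 2) * (((p : ℝ) - 1) / (p : ℝ) ^ (s + 1)) := by
      intro s
      have hp' : (0 : ℝ) < p := by positivity
      field_simp
      ring
    simp_rw [hterm]
    rw [tsum_mul_left, (hasSum_pred_div_pow hp).tsum_eq, mul_one]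

/-- exact evaluation of the cell average of
`1 + γ(1 - (h ⊕_p (σ_m + δ)))`. -/
theorem cell_average_linear_term
    (p : ℕ) (hp : p.Prime) (m : ℕ) (hm : 0 < m)
    (h σm : ℝ) (hh : QSet p m h) (hσ : QSet p m σm)
    (γ : ℝ) (hγ : 0 < γ) :
    (p : ℝ) ^ m *
        ∫ δ in Set.Ico (0 : ℝ) (((p : ℝ) ^ m)⁻¹),
          (1 + γ * (1 - pshift p h (σm + δ))) =
      -(γ / 2) * ((p : ℝ) ^ m)⁻¹ + 1 + γ - γ * simpShift p m h σm := by
  obtain ⟨a, ha, rfl⟩ := hσ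
  have hp0 : (0 : ℝ) < p := by exact_mod_cast hp.pos
  have hpm : (0 : ℝ) < (p : ℝ) ^ m := by positivity
  have hpre : (fun δ : ℝ => (a : ℝ) / (p : ℝ) ^ m + δ) ⁻¹'
      Set.Ico ((a : ℝ) / (p : ℝ) ^ m) ((a + 1 : ℕ) / (p : ℝ) ^ m)
        = Set.Ico (0 : ℝ) (((p : ℝ) ^ m)⁻¹) := by
    rw [Set.preimage_const_add_Ico]
    congr 1
    · ring
    · push_cast; ring
  have htrans := (measurePreserving_add_left volume ((a : ℝ) / (p : ℝ) ^ m)).setIntegral_preimage_emb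
    (measurableEmbedding_addLeft _) (fun σ => 1 + γ * (1 - pshift p h σ))
    (Set.Ico ((a : ℝ) / (p : ℝ) ^ m) ((a + 1 : ℕ) / (p : ℝ) ^ m))
  rw [hpre] at htrans
  have hpshift := (integrableOn_pshift_and_hasSum hp.one_lt h m a ha).1
  have hvol : ((a + 1 : ℕ) : ℝ) / (p : ℝ) ^ m - a / (p : ℝ) ^ m = ((p : ℝ) ^ m)⁻¹ := by
    push_cast; ring
  have hlin : ∀ σ, 1 + γ * (1 - pshift p h σ) = (1 + γ) - γ * pshift p h σ := fun σ => by ring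
  rw [htrans]
  simp_rw [hlin]
  rw [integral_sub (integrable_const _) (hpshift.const_mul γ), integral_const_mul,
    setIntegral_pshift hp.one_lt h m a ha, setIntegral_const, Measure.real, Real.volume_Ico, hvol,
    ENNReal.toReal_ofReal (by positivity), smul_eq_mul]
  field_simp
  ring
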